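/- Let T₁, T₂, T₃ : ℝ → M_k(ℂ) be differentiable. Define a connection on ℝ⁴ with coordinates (x₀, x₁, x₂, x₃) by A₀ ≡ 0 and Aᵢ(x) = Tᵢ(x₀) for i = 1, 2, 3, and let F_{μν} be its curvature components. Then the anti-self-duality equations F₀₁ = −F₂₃, F₀₂ = −F₃₁, F₀₃ = −F₁₂ hold at every point of ℝ⁴ if and only if the Nahm equations T₁′(s) + [T₂(s), T₃(s)] = 0, T₂′(s) + [T₃(s), T₁(s)] = 0, T₃′(s) + [T₁(s), T₂(s)] = 0 hold for every s ∈ ℝ. -/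

import Mathlib

open Matrix

attribute [local instance] Matrix.linftyOpNormedAddCommGroup Matrix.linftyOpNormedRing
  Matrix.linftyOpNormedAlgebra

/-- The commutator `[X, Y] = XY - YX` of matrices. -/
noncomputable def matCommutator {k : ℕ} (X Y : Matrix (Fin k) (Fin k) ℂ) : Matrix (Fin k) (Fin k) ℂ :=
  X * Y - Y * X

/-- Curvature components `F_{μν} = ∂_μ A_ν - ∂_ν A_μ + [A_μ, A_ν]` of a connection on `ℝ⁴`. -/
noncomputable def curvature4 {k : ℕ}
    (A : Fin 4 → (Fin 4 → ℝ) → Matrix (Fin k) (Fin k) ℂ) (μ ν : Fin 4) (x : Fin 4 → ℝ) :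
    Matrix (Fin k) (Fin k) ℂ :=
  fderiv ℝ (A ν) x (Pi.single μ 1) - fderiv ℝ (A μ) x (Pi.single ν 1) +
    matCommutator (A μ x) (A ν x)

/-- The connection on `ℝ⁴` with `A₀ = 0` and `Aᵢ(x) = Tᵢ(x₀)` for `i = 1, 2, 3`. -/
noncomputable def nahmConnection {k : ℕ} (T₁ T₂ T₃ : ℝ → Matrix (Fin k) (Fin k) ℂ) :
    Fin 4 → (Fin 4 → ℝ) → Matrix (Fin k) (Fin k) ℂ :=
  ![0, fun x => T₁ (x 0), fun x => T₂ (x 0), fun x => T₃ (x 0)]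

/-- Chain rule for a function of a single coordinate. -/
theorem fderiv_comp_coord {k : ℕ} {T : ℝ → Matrix (Fin k) (Fin k) ℂ} (hT : Differentiable ℝ T)
    (i : Fin 4) (x v : Fin 4 → ℝ) :
    fderiv ℝ (fun y : Fin 4 → ℝ => T (y i)) x v = v i • deriv T (x i) := by
  have h := (hT (x i)).hasFDerivAt.comp x (hasFDerivAt_apply (𝕜 := ℝ) i x)
  exact (congrArg (fun L => L v) h.fderiv).trans (fderiv_eq_smul_deriv (v i))

/-- `F₀ᵢ` of a connection whose component `A₀` vanishes and `Aᵢ` depends on `x₀` only. -/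
theorem curvature4_zero_left {k : ℕ} {A : Fin 4 → (Fin 4 → ℝ) → Matrix (Fin k) (Fin k) ℂ}
    {T : ℝ → Matrix (Fin k) (Fin k) ℂ} {i : Fin 4} (hT : Differentiable ℝ T) (hA₀ : A 0 = 0)
    (hA : A i = fun x => T (x 0)) (x : Fin 4 → ℝ) : curvature4 A 0 i x = deriv T (x 0) := by
  simp [curvature4, matCommutator, hA₀, hA, fderiv_comp_coord hT]

/-- Spatial curvature components of a connection depending on `x₀` only are commutators. -/
theorem curvature4_spatial {k : ℕ} {A : Fin 4 → (Fin 4 → ℝ) → Matrix (Fin k) (Fin k) ℂ}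
    {S T : ℝ → Matrix (Fin k) (Fin k) ℂ} {i j : Fin 4} (hS : Differentiable ℝ S)
    (hT : Differentiable ℝ T) (hi : i ≠ 0) (hj : j ≠ 0) (hAi : A i = fun x => S (x 0))
    (hAj : A j = fun x => T (x 0)) (x : Fin 4 → ℝ) :
    curvature4 A i j x = matCommutator (S (x 0)) (T (x 0)) := by
  simp [curvature4, hAi, hAj, fderiv_comp_coord hS, fderiv_comp_coord hT,
    Pi.single_eq_of_ne hi.symm, Pi.single_eq_of_ne hj.symm]

/-- For differentiable `T₁, T₂, T₃ : ℝ → M_k(ℂ)`, the connection with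
`A₀ = 0`, `Aᵢ(x) = Tᵢ(x₀)` is anti-self-dual (`F₀₁ = -F₂₃`, `F₀₂ = -F₃₁`, `F₀₃ = -F₁₂`
everywhere) if and only if the Nahm equations
`Tᵢ′ + [Tⱼ, Tₗ] = 0` (cyclic in `(i,j,l)`) hold for every `s ∈ ℝ`. -/
theorem asd_iff_nahm (k : ℕ) (T₁ T₂ T₃ : ℝ → Matrix (Fin k) (Fin k) ℂ)
    (h₁ : Differentiable ℝ T₁) (h₂ : Differentiable ℝ T₂) (h₃ : Differentiable ℝ T₃) :
    (∀ x : Fin 4 → ℝ,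
        curvature4 (nahmConnection T₁ T₂ T₃) 0 1 x = -curvature4 (nahmConnection T₁ T₂ T₃) 2 3 x ∧
        curvature4 (nahmConnection T₁ T₂ T₃) 0 2 x = -curvature4 (nahmConnection T₁ T₂ T₃) 3 1 x ∧
        curvature4 (nahmConnection T₁ T₂ T₃) 0 3 x = -curvature4 (nahmConnection T₁ T₂ T₃) 1 2 x)
      ↔
    (∀ s : ℝ,
        deriv T₁ s + matCommutator (T₂ s) (T₃ s) = 0 ∧
        deriv T₂ s + matCommutator (T₃ s) (T₁ s) = 0 ∧
        deriv T₃ s + matCommutator (T₁ s) (T₂ s) = 0) := by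
  have h₀₁ := curvature4_zero_left (A := nahmConnection T₁ T₂ T₃) (i := 1) h₁ rfl rfl
  have h₀₂ := curvature4_zero_left (A := nahmConnection T₁ T₂ T₃) (i := 2) h₂ rfl rfl
  have h₀₃ := curvature4_zero_left (A := nahmConnection T₁ T₂ T₃) (i := 3) h₃ rfl rfl
  have h₂₃ := curvature4_spatial (A := nahmConnection T₁ T₂ T₃) (i := 2) (j := 3) h₂ h₃
    (by decide) (by decide) rfl rfl
  have h₃₁ := curvature4_spatial (A := nahmConnection T₁ T₂ T₃) (i := 3) (j := 1) h₃ h₁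
    (by decide) (by decide) rfl rfl
  have h₁₂ := curvature4_spatial (A := nahmConnection T₁ T₂ T₃) (i := 1) (j := 2) h₁ h₂
    (by decide) (by decide) rfl rfl
  simp only [h₀₁, h₀₂, h₀₃, h₂₃, h₃₁, h₁₂, eq_neg_iff_add_eq_zero]
  exact ⟨fun h s => h fun _ => s, fun h x => h (x 0)⟩
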